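/- arXiv:2502.06526 — 2 statements merged into one kernel-verified Lean document; each statement's English description precedes it below -/
import Mathlib

section
/- Let n be a positive integer, ρ a density matrix on R⊗A, and σ a density matrix on A. For each x ∈ {1,…,n} let τ_x = ρ^{RA_x} ⊗ (⊗_{i≠x} σ^{A_i}) on R⊗A₁⊗…⊗A_n (each A_i a copy of A), let τ = (1/n) Σ_{x=1}^n τ_x, and set μ := Q₂(ρ^{RA} ‖ ρ^R ⊗ σ) − 1 with ρ^R = Tr_A ρ. Then P²(τ, ρ^R ⊗ σ^{⊗n}) ≤ μ/(μ + n). -/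
open scoped Matrix Kronecker BigOperators ENNReal ComplexOrder Classical

noncomputable section

variable {d : Type*} [Fintype d] [DecidableEq d]

/-- Apply a real function to the eigenvalues of a Hermitian matrix (spectral
functional calculus). -/
def herFun {A : Matrix d d ℂ} (hA : A.IsHermitian) (f : ℝ → ℝ) : Matrix d d ℂ :=
  (hA.eigenvectorUnitary : Matrix d d ℂ) *
    Matrix.diagonal (fun i => (f (hA.eigenvalues i) : ℂ)) *
    (hA.eigenvectorUnitary : Matrix d d ℂ)ᴴ

/-- Functional calculus, extended by the junk value `0` to non-Hermitian matrices. -/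
def matFun (A : Matrix d d ℂ) (f : ℝ → ℝ) : Matrix d d ℂ :=
  if h : A.IsHermitian then herFun h f else 0

/-- Real power of a Hermitian matrix, taken on its support (Moore–Penrose
convention: zero eigenvalues are sent to zero; negative powers are pseudo-inverses). -/
def matPow (A : Matrix d d ℂ) (r : ℝ) : Matrix d d ℂ :=
  matFun A (fun x => if x = 0 then 0 else Real.rpow x r)

/-- Logarithm of a Hermitian matrix on its support. -/
def matLog (A : Matrix d d ℂ) : Matrix d d ℂ := matFun A Real.log

/-- A density matrix: positive semidefinite with unit trace. -/
def IsDensity (A : Matrix d d ℂ) : Prop := A.PosSemidef ∧ A.trace = 1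

/-- `suppLE ρ σ` : the support of `ρ` is contained in the support of `σ`
(for Hermitian matrices this is equivalent to `ker σ ≤ ker ρ`). -/
def suppLE (ρ σ : Matrix d d ℂ) : Prop :=
  LinearMap.ker σ.mulVecLin ≤ LinearMap.ker ρ.mulVecLin

/-- Trace (nuclear) norm of a matrix: `Tr √(AᴴA)`. -/
def traceNorm (A : Matrix d d ℂ) : ℝ := (Matrix.trace (matPow (Aᴴ * A) (1/2))).re

/-- The real-valued collision quantity `Tr[ρ σ^{-1/2} ρ σ^{-1/2}]`. -/
def Q2R (ρ σ : Matrix d d ℂ) : ℝ :=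
  (Matrix.trace (ρ * matPow σ (-(1/2)) * ρ * matPow σ (-(1/2)))).re

/-- `Q₂(ρ‖σ) = Tr[ρ σ^{-1/2} ρ σ^{-1/2}]`, equal to `+∞` unless `supp ρ ⊆ supp σ`. -/
def Q2 (ρ σ : Matrix d d ℂ) : ℝ≥0∞ :=
  if suppLE ρ σ then ENNReal.ofReal (Q2R ρ σ) else ∞

/-- Collision relative entropy `D₂(ρ‖σ) = log Q₂(ρ‖σ)`. -/
def D2 (ρ σ : Matrix d d ℂ) : EReal := ENNReal.log (Q2 ρ σ)

/-- Fidelity `F(ρ,σ) = ‖√ρ √σ‖₁`. -/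
def fidelity (ρ σ : Matrix d d ℂ) : ℝ := traceNorm (matPow ρ (1/2) * matPow σ (1/2))

/-- Purified distance `P(ρ,σ) = √(1 - F(ρ,σ)²)`. -/
def purifiedDist (ρ σ : Matrix d d ℂ) : ℝ := Real.sqrt (1 - fidelity ρ σ ^ 2)

variable {R A : Type*} [Fintype R] [DecidableEq R] [Fintype A] [DecidableEq A]

/-- Partial trace over the second tensor factor. -/
def ptrace2 (ρ : Matrix (R × A) (R × A) ℂ) : Matrix R R ℂ :=
  Matrix.of fun i j => ∑ a : A, ρ (i, a) (j, a)

/-- `n`-fold tensor power `σ^{⊗n}` of a matrix `σ`. -/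
def tpow (σ : Matrix A A ℂ) (n : ℕ) : Matrix (Fin n → A) (Fin n → A) ℂ :=
  Matrix.of fun v w => ∏ k, σ (v k) (w k)

/-- The state `τ_x = ρ^{R A_x} ⊗ (⊗_{i ≠ x} σ^{A_i})` on `R ⊗ A₁ ⊗ ⋯ ⊗ A_n`. -/
def tauX (ρ : Matrix (R × A) (R × A) ℂ) (σ : Matrix A A ℂ) (n : ℕ) (x : Fin n) :
    Matrix (R × (Fin n → A)) (R × (Fin n → A)) ℂ :=
  Matrix.of fun p q =>
    ρ (p.1, p.2 x) (q.1, q.2 x) * ∏ k ∈ Finset.univ.erase x, σ (p.2 k) (q.2 k)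


/-- `t` is the Moore–Penrose inverse of the positive semidefinite matrix `s`. -/
structure IsPI (s t : Matrix d d ℂ) : Prop where
  hs : s.PosSemidef
  ht : t.PosSemidef
  comm : s * t = t * s
  sts : s * t * s = s
  tst : t * s * t = t

lemma herFun_mul {A : Matrix d d ℂ} (hA : A.IsHermitian) (f g : ℝ → ℝ) :
    herFun hA f * herFun hA g = herFun hA (fun x => f x * g x) := by
  have hU : (hA.eigenvectorUnitary : Matrix d d ℂ)ᴴ * (hA.eigenvectorUnitary : Matrix d d ℂ) = 1 :=
    Unitary.coe_star_mul_self _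
  unfold herFun
  have : ∀ U V D E : Matrix d d ℂ, V * U = 1 → U * D * V * (U * E * V) = U * (D * E) * V := by
    intro U V D E h
    calc U * D * V * (U * E * V) = U * D * (V * U) * E * V := by noncomm_ring
      _ = _ := by rw [h]; noncomm_ring
  rw [this _ _ _ _ hU, Matrix.diagonal_mul_diagonal]
  simp

lemma herFun_congr {A : Matrix d d ℂ} (hA : A.IsHermitian) {f g : ℝ → ℝ}
    (h : ∀ i, f (hA.eigenvalues i) = g (hA.eigenvalues i)) : herFun hA f = herFun hA g := by
  unfold herFun
  simp [h]

lemma herFun_id {A : Matrix d d ℂ} (hA : A.IsHermitian) : herFun hA (fun x => x) = A := by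
  conv_rhs => rw [hA.spectral_theorem]
  rw [Unitary.conjStarAlgAut_apply]
  rfl

lemma herFun_posSemidef {A : Matrix d d ℂ} (hA : A.IsHermitian) {f : ℝ → ℝ}
    (h : ∀ i, 0 ≤ f (hA.eigenvalues i)) : (herFun hA f).PosSemidef := by
  unfold herFun
  apply Matrix.PosSemidef.mul_mul_conjTranspose_same
  apply Matrix.PosSemidef.diagonal
  intro i
  simpa using h i

lemma matPow_isPI {A : Matrix d d ℂ} (hA : A.PosSemidef) :
    IsPI (matPow A (1/2)) (matPow A (-(1/2))) := by
  have h0 := hA.eigenvalues_nonneg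
  have key : ∀ x : ℝ, 0 ≤ x → x ≠ 0 → Real.rpow x (1/2) * Real.rpow x (-(1/2)) = 1 := by
    intro x hx hx0
    change x ^ (1/2 : ℝ) * x ^ (-(1/2) : ℝ) = 1
    rw [← Real.rpow_add (lt_of_le_of_ne hx hx0.symm)]; norm_num
  simp only [matPow, matFun, dif_pos hA.isHermitian]
  refine ⟨herFun_posSemidef _ ?_, herFun_posSemidef _ ?_, ?_, ?_, ?_⟩
  · intro i; split_ifs
    · exact le_rfl
    · exact Real.rpow_nonneg (h0 i) _
  · intro i; split_ifs
    · exact le_rfl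
    · exact Real.rpow_nonneg (h0 i) _
  · rw [herFun_mul, herFun_mul]
    exact herFun_congr _ fun i => mul_comm _ _
  · rw [herFun_mul, herFun_mul]
    refine herFun_congr _ fun i => ?_
    split_ifs with h
    · simp
    · have := key _ (h0 i) h
      rw [this, one_mul]
  · rw [herFun_mul, herFun_mul]
    refine herFun_congr _ fun i => ?_
    split_ifs with h
    · simp
    · have := key _ (h0 i) h
      rw [mul_comm (Real.rpow _ (-(1/2))), this, one_mul]

lemma matPow_half_mul_self {A : Matrix d d ℂ} (hA : A.PosSemidef) :
    matPow A (1/2) * matPow A (1/2) = A := by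
  have h0 := hA.eigenvalues_nonneg
  simp only [matPow, matFun, dif_pos hA.isHermitian]
  rw [herFun_mul]
  conv_rhs => rw [← herFun_id hA.isHermitian]
  refine herFun_congr _ fun i => ?_
  split_ifs with h
  · simp [h]
  · change (hA.isHermitian.eigenvalues i) ^ (1/2 : ℝ) * (hA.isHermitian.eigenvalues i) ^ (1/2 : ℝ) = _
    rw [← Real.rpow_add (lt_of_le_of_ne (h0 i) (Ne.symm h))]; norm_num

lemma trace_mul_nonneg {A B : Matrix d d ℂ} (hA : A.PosSemidef) (hB : B.PosSemidef) :
    0 ≤ (A * B).trace.re := by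
  have h1 := matPow_half_mul_self hA
  have h2 := (matPow_isPI hA).hs
  have h3 := (hB.mul_mul_conjTranspose_same (matPow A (1/2))).trace_nonneg
  rw [h2.1.eq, Matrix.trace_mul_comm, ← mul_assoc, h1] at h3
  exact (Complex.le_def.1 h3).1

open scoped MatrixOrder Matrix.Norms.L2Operator in
lemma psd_sq_unique {A B : Matrix d d ℂ} (hA : A.PosSemidef) (hB : B.PosSemidef)
    (h : A * A = B * B) : A = B := by
  have h1 := CFC.sqrt_unique (a := A * A) (b := A) rfl hA.nonneg
  have h2 := CFC.sqrt_unique (a := A * A) (b := B) h.symm hB.nonneg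
  rw [← h1, h2]

set_option linter.unusedSectionVars false

lemma IsPI.unique {s t t' : Matrix d d ℂ} (h : IsPI s t) (h' : IsPI s t') : t = t' := by
  have e1 : s * t = s * t * (s * t') := by
    calc s * t = t * s := h.comm
      _ = t * (s * t' * s) := by rw [h'.sts]
      _ = (t * s) * (t' * s) := by noncomm_ring
      _ = _ := by rw [← h.comm, ← h'.comm]
  have e2 : s * t' = s * t * (s * t') := by
    calc s * t' = (s * t * s) * t' := by rw [h.sts]
      _ = _ := by noncomm_ring
  have e : s * t = s * t' := e1.trans e2.symm
  calc t = t * (s * t) := by rw [← mul_assoc, h.tst]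
    _ = (t * s) * t' := by rw [e, mul_assoc]
    _ = (s * t') * t' := by rw [← h.comm, e]
    _ = t' := by rw [h'.comm, h'.tst]

lemma matPow_half_sq {s : Matrix d d ℂ} (hs : s.PosSemidef) : matPow (s * s) (1/2) = s := by
  have h : (s * s).PosSemidef := by
    have := Matrix.posSemidef_conjTranspose_mul_self s
    rwa [hs.1.eq] at this
  exact psd_sq_unique (matPow_isPI h).hs hs (matPow_half_mul_self h)

lemma matPow_neg_half_sq {s t : Matrix d d ℂ} (hs : IsPI s t) : matPow (s * s) (-(1/2)) = t := by
  have h : (s * s).PosSemidef := by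
    have := Matrix.posSemidef_conjTranspose_mul_self s
    rwa [hs.hs.1.eq] at this
  have := matPow_isPI h
  rw [matPow_half_sq hs.hs] at this
  exact this.unique hs

/-- `Tr[D t D t] ≥ 0`. -/
lemma trace_DtDt {D t : Matrix d d ℂ} (hD : D.IsHermitian) (ht : t.PosSemidef) :
    0 ≤ (D * t * D * t).trace.re := by
  have := ht.mul_mul_conjTranspose_same D
  rw [hD.eq] at this
  exact trace_mul_nonneg this ht

lemma trace_comm_bound {s W : Matrix d d ℂ} (hs : s.IsHermitian) (hW : W.IsHermitian) :
    (s * W * s * W).trace.re ≤ (W * W * (s * s)).trace.re := by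
  have h := (Matrix.posSemidef_conjTranspose_mul_self (s * W - W * s)).trace_nonneg
  have h := (Complex.le_def.1 h).1
  have e : (s * W - W * s)ᴴ * (s * W - W * s)
      = W * (s * s * W) - W * (s * W * s) - s * W * s * W + s * (W * W * s) := by
    rw [Matrix.conjTranspose_sub, Matrix.conjTranspose_mul, Matrix.conjTranspose_mul, hs.eq, hW.eq]
    noncomm_ring
  rw [e, Matrix.trace_add, Matrix.trace_sub, Matrix.trace_sub, Matrix.trace_mul_comm W,
    Matrix.trace_mul_comm W (s * W * s), Matrix.trace_mul_comm s (W * W * s),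
    mul_assoc (s * s), Matrix.trace_mul_comm (s * s), mul_assoc (W * W) s s] at h
  simp only [Complex.zero_re, Complex.add_re, Complex.sub_re] at h
  linarith

lemma poly_bound {Z ω : Matrix d d ℂ} (hZ : Z.PosSemidef) (hω : ω.PosSemidef) {c : ℝ} (hc : 0 ≤ c) :
    3 * c ^ 2 * (Z * Z * ω).trace.re ≤
      (Z * Z * (Z * Z) * ω).trace.re + 2 * c ^ 3 * (Z * ω).trace.re := by
  set Y : Matrix d d ℂ := Z - (c : ℂ) • 1 with hY
  have hYh : Yᴴ = Y := by
    simp [hY, Matrix.conjTranspose_sub, Matrix.conjTranspose_smul, hZ.1.eq]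
  have hZZ : (Z * Z).PosSemidef := by
    have := Matrix.posSemidef_conjTranspose_mul_self Z
    rwa [hZ.1.eq] at this
  have h1 := trace_mul_nonneg (hZZ.mul_mul_conjTranspose_same Y) hω
  have h2 := trace_mul_nonneg (hZ.mul_mul_conjTranspose_same Y) hω
  rw [hYh] at h1 h2
  have e1 : Y * (Z * Z) * Y * ω = Z * Z * (Z * Z) * ω - ((2 * c : ℝ) : ℂ) • (Z * Z * Z * ω)
      + ((c ^ 2 : ℝ) : ℂ) • (Z * Z * ω) := by
    simp only [hY, sub_mul, mul_sub, smul_mul_assoc, mul_smul_comm, one_mul, mul_one, smul_sub,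
      smul_smul, mul_assoc]
    push_cast
    module
  have e2 : Y * Z * Y * ω = Z * Z * Z * ω - ((2 * c : ℝ) : ℂ) • (Z * Z * ω)
      + ((c ^ 2 : ℝ) : ℂ) • (Z * ω) := by
    simp only [hY, sub_mul, mul_sub, smul_mul_assoc, mul_smul_comm, one_mul, mul_one, smul_sub,
      smul_smul, mul_assoc]
    push_cast
    module
  rw [e1] at h1
  rw [e2] at h2
  simp only [Matrix.trace_add, Matrix.trace_sub, Matrix.trace_smul, smul_eq_mul, Complex.add_re,
    Complex.sub_re, Complex.re_ofReal_mul] at h1 h2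
  nlinarith [mul_nonneg hc h2]

lemma q2_lower {s t τ W : Matrix d d ℂ} (h : IsPI s t) (hτ : τ.IsHermitian)
    (hsupp : τ * (s * t) = τ) (hsupp' : s * t * τ = τ) (hW : W.IsHermitian)
    (e4 : (τ * W).trace = (W * W * (s * s)).trace) :
    (W * W * (s * s)).trace.re ≤ (τ * t * τ * t).trace.re := by
  obtain ⟨hs, ht, comm, sts, tst⟩ := h
  have hts : t * s = s * t := comm.symm
  have hD : (τ - s * W * s).IsHermitian := by
    change (τ - s * W * s)ᴴ = _
    rw [Matrix.conjTranspose_sub, Matrix.conjTranspose_mul, Matrix.conjTranspose_mul, hτ.eq,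
      hs.1.eq, hW.eq, mul_assoc]
  have h1 := trace_DtDt hD ht
  have e : (τ - s * W * s) * t * (τ - s * W * s) * t
      = τ * t * τ * t - (τ * (t * s) * W * (s * t)) - s * (W * (s * t * τ) * t)
        + s * (W * (s * t * s) * W * (s * t)) := by noncomm_ring
  have t1 : (τ * (t * s) * W * (s * t)).trace = (τ * W).trace := by
    rw [hts, hsupp, Matrix.trace_mul_comm, ← mul_assoc, hsupp']
  have t2 : (s * (W * (s * t * τ) * t)).trace = (τ * W).trace := by
    rw [hsupp', Matrix.trace_mul_comm, mul_assoc, hts, mul_assoc, hsupp, Matrix.trace_mul_comm]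
  have t3 : (s * (W * (s * t * s) * W * (s * t))).trace = (s * W * s * W).trace := by
    rw [sts, Matrix.trace_mul_comm, mul_assoc (W * s * W), sts, mul_assoc, mul_assoc,
      Matrix.trace_mul_comm]
    simp only [mul_assoc]
  rw [e, Matrix.trace_add, Matrix.trace_sub, Matrix.trace_sub, t1, t2, t3, e4] at h1
  have h2 := trace_comm_bound hs.1 hW
  simp only [Complex.add_re, Complex.sub_re] at h1
  linarith

lemma fid_core {s t τ G : Matrix d d ℂ} (h : IsPI s t) (hτ : τ.PosSemidef)
    (hsupp : τ * (s * t) = τ) (htr : τ.trace = 1) (hG : G.PosSemidef) (hGG : G * G = s * τ * s) :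
    1 ≤ G.trace.re ^ 2 * (τ * t * τ * t).trace.re := by
  obtain ⟨hs, ht, comm, sts, tst⟩ := h
  have hP : (s * t)ᴴ = s * t := by rw [Matrix.conjTranspose_mul, hs.1.eq, ht.1.eq, comm]
  have hsupp' : s * t * τ = τ := by
    have := congrArg Matrix.conjTranspose hsupp
    rwa [Matrix.conjTranspose_mul, hP, hτ.1.eq] at this
  have hGP : G * (s * t) = G := by
    have h0 : G - G * (s * t) = 0 := by
      rw [← Matrix.conjTranspose_mul_self_eq_zero]
      have : (G - G * (s * t))ᴴ * (G - G * (s * t))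
          = G * G - G * G * (s * t) - s * t * (G * G - G * G * (s * t)) := by
        rw [Matrix.conjTranspose_sub, Matrix.conjTranspose_mul, hP, hG.1.eq]; noncomm_ring
      have h1 : G * G * (s * t) = G * G := by
        rw [hGG, comm]
        calc s * τ * s * (t * s) = s * τ * (s * t * s) := by noncomm_ring
          _ = _ := by rw [sts]
      rw [this, h1]; simp
    exact (sub_eq_zero.1 h0).symm
  have hPG : s * t * G = G := by
    have := congrArg Matrix.conjTranspose hGP
    rwa [Matrix.conjTranspose_mul, hP, hG.1.eq] at this
  have hts : t * s = s * t := comm.symm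
  set Z := t * G * t with hZdef
  have hZ : Z.PosSemidef := by
    have := hG.mul_mul_conjTranspose_same t
    rwa [ht.1.eq] at this
  have hω : (s * s).PosSemidef := by
    have := Matrix.posSemidef_conjTranspose_mul_self s
    rwa [hs.1.eq] at this
  have hW : (Z * Z).IsHermitian := by
    change (Z * Z)ᴴ = Z * Z
    rw [Matrix.conjTranspose_mul, hZ.1.eq]
  have hZωZ : Z * (s * s) * Z = τ := by
    calc Z * (s * s) * Z = t * (G * (t * s)) * (s * t * G) * t := by rw [hZdef]; noncomm_ring
      _ = t * (G * G) * t := by rw [hts, hGP, hPG]; noncomm_ring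
      _ = (t * s) * τ * (s * t) := by rw [hGG]; noncomm_ring
      _ = τ := by rw [hts, hsupp', hsupp]
  have S1 : (Z * (s * s)).trace = G.trace := by
    calc (Z * (s * s)).trace = (t * (G * (t * s) * s)).trace := by rw [hZdef]; congr 1; noncomm_ring
      _ = (G * (s * t)).trace := by
          rw [hts, hGP, Matrix.trace_mul_comm, mul_assoc, hGP]
      _ = G.trace := by rw [hGP]
  have S2 : (Z * Z * (s * s)).trace = 1 := by
    rw [mul_assoc, Matrix.trace_mul_comm, hZωZ, htr]
  have S4 : (Z * Z * (Z * Z) * (s * s)).trace.re ≤ (τ * t * τ * t).trace.re := by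
    refine q2_lower ⟨hs, ht, comm, sts, tst⟩ hτ.1 hsupp hsupp' hW ?_
    calc (τ * (Z * Z)).trace = (Z * ((s * s) * Z * (Z * Z))).trace := by
          rw [← hZωZ]; simp only [mul_assoc]
      _ = ((s * s) * (Z * Z * (Z * Z))).trace := by
          rw [Matrix.trace_mul_comm]; simp only [mul_assoc]
      _ = _ := Matrix.trace_mul_comm _ _
  have hF : 0 ≤ G.trace.re := (Complex.le_def.1 hG.trace_nonneg).1
  have hQ : 0 ≤ (τ * t * τ * t).trace.re := trace_DtDt hτ.1 ht
  have hpoly : ∀ c : ℝ, 0 ≤ c → 3 * c ^ 2 ≤ (τ * t * τ * t).trace.re + 2 * c ^ 3 * G.trace.re := by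
    intro c hc
    have := poly_bound hZ hω hc
    rw [S1, S2] at this
    simp only [Complex.one_re, mul_one] at this
    linarith
  generalize G.trace.re = F at *
  generalize (τ * t * τ * t).trace.re = Q at *
  rcases hF.eq_or_lt with h0 | h0
  · have := hpoly (Q + 1) (by linarith)
    rw [← h0] at this
    nlinarith
  · have := hpoly (1 / F) (by positivity)
    have e : F ^ 2 * (3 * (1 / F) ^ 2) ≤ F ^ 2 * (Q + 2 * (1 / F) ^ 3 * F) :=
      mul_le_mul_of_nonneg_left this (by positivity)
    have e1 : F ^ 2 * (3 * (1 / F) ^ 2) = 3 := by field_simp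
    have e2 : F ^ 2 * (Q + 2 * (1 / F) ^ 3 * F) = F ^ 2 * Q + 2 := by field_simp
    linarith

lemma fid_bound {s t τ : Matrix d d ℂ} (h : IsPI s t) (hτ : τ.PosSemidef)
    (hsupp : τ * (s * t) = τ) (htr : τ.trace = 1) :
    1 ≤ fidelity τ (s * s) ^ 2 * (τ * t * τ * t).trace.re := by
  unfold fidelity traceNorm
  have hr := (matPow_isPI hτ).hs
  have hrr := matPow_half_mul_self hτ
  have e : (matPow τ (1/2) * matPow (s * s) (1/2))ᴴ * (matPow τ (1/2) * matPow (s * s) (1/2))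
      = s * τ * s := by
    rw [matPow_half_sq h.hs, Matrix.conjTranspose_mul, hr.1.eq, h.hs.1.eq]
    conv_rhs => rw [← hrr]
    noncomm_ring
  have hp : (s * τ * s).PosSemidef := by
    rw [← e]; exact Matrix.posSemidef_conjTranspose_mul_self _
  rw [e]
  exact fid_core h hτ hsupp htr (matPow_isPI hp).hs (matPow_half_mul_self hp)

lemma sum_prod_fn {n : ℕ} (f : Fin n → A → ℂ) :
    ∑ v : Fin n → A, ∏ k, f k (v k) = ∏ k, ∑ a, f k a := by
  rw [Finset.prod_univ_sum, Fintype.piFinset_univ]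

lemma tauX_apply' (M : Matrix (R × A) (R × A) ℂ) (X : Matrix A A ℂ) (n : ℕ) (x : Fin n)
    (p q : R × (Fin n → A)) :
    tauX M X n x p q =
      ∏ k, if k = x then M (p.1, p.2 k) (q.1, q.2 k) else X (p.2 k) (q.2 k) := by
  rw [← Finset.mul_prod_erase _ _ (Finset.mem_univ x)]
  simp only [tauX, Matrix.of_apply, if_true]
  congr 1
  refine Finset.prod_congr rfl fun k hk => ?_
  rw [if_neg (Finset.ne_of_mem_erase hk)]

lemma tauX_mul (M N : Matrix (R × A) (R × A) ℂ) (X Y : Matrix A A ℂ) (n : ℕ) (x : Fin n) :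
    tauX M X n x * tauX N Y n x = tauX (M * N) (X * Y) n x := by
  ext p q
  have : ∀ r : R, ∑ w : Fin n → A, tauX M X n x p (r, w) * tauX N Y n x (r, w) q
      = (∑ a, M (p.1, p.2 x) (r, a) * N (r, a) (q.1, q.2 x)) *
        ∏ k ∈ Finset.univ.erase x, (X * Y) (p.2 k) (q.2 k) := by
    intro r
    simp only [tauX_apply', ← Finset.prod_mul_distrib]
    rw [sum_prod_fn (fun k a => (if k = x then M (p.1, p.2 k) (r, a) else X (p.2 k) a) *
      (if k = x then N (r, a) (q.1, q.2 k) else Y a (q.2 k))),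
      ← Finset.mul_prod_erase _ _ (Finset.mem_univ x)]
    simp only [if_true]
    congr 1
    refine Finset.prod_congr rfl fun k hk => ?_
    simp only [if_neg (Finset.ne_of_mem_erase hk), Matrix.mul_apply]
  rw [Matrix.mul_apply, Fintype.sum_prod_type]
  simp only [this]
  rw [← Finset.sum_mul]
  simp only [tauX, Matrix.of_apply]
  rw [Matrix.mul_apply, Fintype.sum_prod_type]

lemma tauX_trace (M : Matrix (R × A) (R × A) ℂ) (X : Matrix A A ℂ) (n : ℕ) (x : Fin n)
    (hX : X.trace = 1) : (tauX M X n x).trace = M.trace := by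
  simp only [Matrix.trace, Matrix.diag_apply] at hX ⊢
  rw [Fintype.sum_prod_type, Fintype.sum_prod_type]
  refine Finset.sum_congr rfl fun r _ => ?_
  simp only [tauX_apply']
  rw [sum_prod_fn (fun k a => if k = x then M (r, a) (r, a) else X a a),
    ← Finset.mul_prod_erase _ _ (Finset.mem_univ x), Finset.prod_eq_one, mul_one]
  · simp
  · intro k hk
    simp only [if_neg (Finset.ne_of_mem_erase hk), hX]

lemma tauX_conjTranspose (M : Matrix (R × A) (R × A) ℂ) (X : Matrix A A ℂ) (n : ℕ) (x : Fin n) :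
    (tauX M X n x)ᴴ = tauX Mᴴ Xᴴ n x := by
  ext p q
  simp only [Matrix.conjTranspose_apply, tauX, Matrix.of_apply, star_mul', star_prod]

lemma tauX_posSemidef {M : Matrix (R × A) (R × A) ℂ} {X : Matrix A A ℂ} (n : ℕ) (x : Fin n)
    (hM : M.PosSemidef) (hX : X.PosSemidef) : (tauX M X n x).PosSemidef := by
  have h := Matrix.posSemidef_conjTranspose_mul_self
    (tauX (matPow M (1/2)) (matPow X (1/2)) n x)
  rwa [tauX_conjTranspose, tauX_mul, (matPow_isPI hM).hs.1.eq, (matPow_isPI hX).hs.1.eq,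
    matPow_half_mul_self hM, matPow_half_mul_self hX] at h

lemma kron_tpow (a : Matrix R R ℂ) (b : Matrix A A ℂ) (n : ℕ) (x : Fin n) :
    a ⊗ₖ tpow b n = tauX (a ⊗ₖ b) b n x := by
  ext p q
  simp only [tauX, Matrix.of_apply, tpow, Matrix.kroneckerMap_apply]
  rw [← Finset.mul_prod_erase _ _ (Finset.mem_univ x), mul_assoc]

lemma IsPI.tauX {M M' : Matrix (R × A) (R × A) ℂ} {X X' : Matrix A A ℂ} (n : ℕ) (x : Fin n)
    (h : IsPI M M') (h' : IsPI X X') : IsPI (tauX M X n x) (_root_.tauX M' X' n x) where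
  hs := tauX_posSemidef n x h.hs h'.hs
  ht := tauX_posSemidef n x h.ht h'.ht
  comm := by rw [tauX_mul, tauX_mul, h.comm, h'.comm]
  sts := by rw [tauX_mul, tauX_mul, h.sts, h'.sts]
  tst := by rw [tauX_mul, tauX_mul, h.tst, h'.tst]

lemma IsPI.kron {M M' : Matrix R R ℂ} {X X' : Matrix A A ℂ}
    (h : IsPI M M') (h' : IsPI X X') : IsPI (M ⊗ₖ X) (M' ⊗ₖ X') where
  hs := h.hs.kronecker h'.hs
  ht := h.ht.kronecker h'.ht
  comm := by rw [← Matrix.mul_kronecker_mul, ← Matrix.mul_kronecker_mul, h.comm, h'.comm]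
  sts := by rw [← Matrix.mul_kronecker_mul, ← Matrix.mul_kronecker_mul, h.sts, h'.sts]
  tst := by rw [← Matrix.mul_kronecker_mul, ← Matrix.mul_kronecker_mul, h.tst, h'.tst]

lemma tauX_cross (M N : Matrix (R × A) (R × A) ℂ) (X Y : Matrix A A ℂ) (n : ℕ) (x y : Fin n)
    (hxy : x ≠ y) (hXY : (X * Y).trace = 1) (hN : ((1 : Matrix R R ℂ) ⊗ₖ X) * N = N) :
    (tauX M X n x * tauX N Y n y).trace = (M * (ptrace2 N ⊗ₖ Y)).trace := by
  have key : ∀ r r' : R, ∑ v : Fin n → A, ∑ w : Fin n → A,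
      tauX M X n x (r, v) (r', w) * tauX N Y n y (r', w) (r, v)
      = (∑ a, ∑ b, M (r, a) (r', b) * Y b a) * ptrace2 N r' r := by
    intro r r'
    simp only [tauX_apply', ← Finset.prod_mul_distrib]
    have h1 : ∀ v : Fin n → A, _ := fun v => sum_prod_fn (fun k b =>
      (if k = x then M (r, v k) (r', b) else X (v k) b) *
      (if k = y then N (r', b) (r, v k) else Y b (v k)))
    simp only [h1]
    rw [sum_prod_fn (fun k a => ∑ b, (if k = x then M (r, a) (r', b) else X a b) *
      (if k = y then N (r', b) (r, a) else Y b a))]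
    rw [Finset.prod_eq_mul x y hxy]
    · simp only [if_true, if_neg hxy, if_neg hxy.symm]
      congr 1
      simp only [ptrace2, Matrix.of_apply]
      conv_rhs => rw [← hN]
      simp only [Matrix.mul_apply, Fintype.sum_prod_type, Matrix.kroneckerMap_apply,
        Matrix.one_apply, ite_mul, one_mul, zero_mul]
      refine Finset.sum_congr rfl fun a _ => ?_
      rw [Finset.sum_comm]
      simp
    · intro k _ hk
      simp only [if_neg hk.1, if_neg hk.2]
      simpa [Matrix.trace, Matrix.mul_apply] using hXY
    · simp
    · simp
  simp only [Matrix.trace, Matrix.diag_apply, Matrix.mul_apply, Fintype.sum_prod_type,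
    Matrix.kroneckerMap_apply]
  refine Finset.sum_congr rfl fun r _ => ?_
  rw [Finset.sum_comm]
  conv_rhs => rw [Finset.sum_comm]
  refine Finset.sum_congr rfl fun r' _ => ?_
  rw [key, Finset.sum_mul]
  refine Finset.sum_congr rfl fun a _ => ?_
  rw [Finset.sum_mul]
  refine Finset.sum_congr rfl fun b _ => ?_
  ring

lemma ptrace2_trace (ρ : Matrix (R × A) (R × A) ℂ) : (ptrace2 ρ).trace = ρ.trace := by
  simp only [Matrix.trace, Matrix.diag_apply, Fintype.sum_prod_type, ptrace2, Matrix.of_apply]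

lemma ptrace2_posSemidef {ρ : Matrix (R × A) (R × A) ℂ} (h : ρ.PosSemidef) :
    (ptrace2 ρ).PosSemidef := by
  have : ptrace2 ρ = ∑ a : A, ρ.submatrix (fun r => (r, a)) (fun r => (r, a)) := by
    ext i j
    simp [ptrace2, Matrix.sum_apply]
  rw [this]
  exact Matrix.posSemidef_sum _ fun a _ => h.submatrix _

lemma supp_mul {ρ s t : Matrix d d ℂ} (h : IsPI s t) (hs : suppLE ρ (s * s)) :
    ρ * (s * t) = ρ := by
  have h0 : s * s * (1 - s * t) = 0 := by
    rw [mul_sub, mul_one, h.comm]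
    have : s * s * (t * s) = s * (s * t * s) := by simp only [mul_assoc]
    rw [this, h.sts, sub_self]
  have h1 : ρ * (1 - s * t) = 0 := by
    ext i j
    have hk : (1 - s * t).col j ∈ LinearMap.ker (s * s).mulVecLin := by
      rw [LinearMap.mem_ker]
      ext k
      exact congrFun (congrFun h0 k) j
    have := hs hk
    rw [LinearMap.mem_ker] at this
    exact congrFun this i
  rw [mul_sub, mul_one] at h1
  exact (sub_eq_zero.1 h1).symm

/-- `Q₂(ρ‖ω) ≥ 1`. -/
lemma q2_ge_one {ρ s t : Matrix d d ℂ} (h : IsPI s t) (hρ : ρ.IsHermitian)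
    (hsupp : ρ * (s * t) = ρ) (htr : ρ.trace = 1) (hω : (s * s).trace = 1) :
    1 ≤ (ρ * t * ρ * t).trace.re := by
  obtain ⟨hs, ht, comm, sts, tst⟩ := h
  have hD : (ρ - s * s).IsHermitian := by
    change (ρ - s * s)ᴴ = _
    rw [Matrix.conjTranspose_sub, Matrix.conjTranspose_mul, hρ.eq, hs.1.eq]
  have h1 := trace_DtDt hD ht
  have e : (ρ - s * s) * t * (ρ - s * s) * t
      = ρ * t * ρ * t - ρ * (t * s) * (s * t) - s * s * t * (ρ * t)
        + s * (s * t * s) * (s * t) := by noncomm_ring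
  have t1 : (ρ * (t * s) * (s * t)).trace = 1 := by
    rw [← comm, hsupp, hsupp, htr]
  have t2 : (s * s * t * (ρ * t)).trace = 1 := by
    rw [Matrix.trace_mul_comm]
    have : ρ * t * (s * s * t) = ρ * (t * s) * (s * t) := by simp only [mul_assoc]
    rw [this, t1]
  have t3 : (s * (s * t * s) * (s * t)).trace = 1 := by
    have : s * (s * t * s) * (s * t) = s * (s * (s * t)) := by rw [sts]; simp only [mul_assoc]
    rw [this, comm, ← mul_assoc s t s, sts, hω]
  rw [e, Matrix.trace_add, Matrix.trace_sub, Matrix.trace_sub, t1, t2, t3] at h1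
  simp only [Complex.add_re, Complex.sub_re, Complex.one_re] at h1
  linarith

lemma trace_pair (n : ℕ) (ρ : Matrix (R × A) (R × A) ℂ) (hρ : IsDensity ρ)
    (σ : Matrix A A ℂ) (hσ : IsDensity σ) {a α : Matrix R R ℂ} {b β : Matrix A A ℂ}
    (ha : IsPI a α) (hb : IsPI b β) (haa : a * a = ptrace2 ρ) (hbb : b * b = σ)
    (hsupp : ρ * ((a ⊗ₖ b) * (α ⊗ₖ β)) = ρ) (x y : Fin n) :
    (tauX ρ σ n x * (α ⊗ₖ tpow β n) * tauX ρ σ n y * (α ⊗ₖ tpow β n)).trace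
      = if y = x then (ρ * (α ⊗ₖ β) * ρ * (α ⊗ₖ β)).trace else 1 := by
  have hM := ha.kron hb
  have hP : ((a ⊗ₖ b) * (α ⊗ₖ β))ᴴ = (a ⊗ₖ b) * (α ⊗ₖ β) := by
    rw [Matrix.conjTranspose_mul, hM.hs.1.eq, hM.ht.1.eq, hM.comm]
  have hsupp' : (a ⊗ₖ b) * (α ⊗ₖ β) * ρ = ρ := by
    have := congrArg Matrix.conjTranspose hsupp
    rwa [Matrix.conjTranspose_mul, hP, hρ.1.1.eq] at this
  have hPi : β * σ * β = b * β := by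
    calc β * σ * β = (β * b) * (b * β) := by rw [← hbb]; simp only [mul_assoc]
      _ = b * β := by rw [← hb.comm, ← mul_assoc, hb.sts]
  have hPiS : b * β * σ = σ := by
    rw [← hbb, ← mul_assoc, hb.sts]
  have hN : ((1 : Matrix R R ℂ) ⊗ₖ (b * β)) * ρ = ρ := by
    conv_lhs => rw [← hsupp']
    rw [← mul_assoc, ← Matrix.mul_kronecker_mul, ← Matrix.mul_kronecker_mul, one_mul,
      ← mul_assoc (b * β), hb.sts, Matrix.mul_kronecker_mul, hsupp']
  have e0 : (tauX ρ σ n x * (α ⊗ₖ tpow β n) * tauX ρ σ n y * (α ⊗ₖ tpow β n)).trace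
      = (tauX ((α ⊗ₖ β) * ρ * (α ⊗ₖ β)) (b * β) n x * tauX ρ σ n y).trace := by
    rw [Matrix.trace_mul_comm, ← mul_assoc, ← mul_assoc, kron_tpow α β n x, tauX_mul, tauX_mul, hPi]
  rw [e0]
  split_ifs with h
  · subst h
    rw [tauX_mul, tauX_trace _ _ _ _ (by rw [hPiS, hσ.2])]
    rw [mul_assoc, mul_assoc, Matrix.trace_mul_comm]
    simp only [mul_assoc]
  · rw [tauX_cross _ _ _ _ _ _ _ (Ne.symm h) (by rw [hPiS, hσ.2]) hN, ← haa, ← hbb,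
      Matrix.mul_kronecker_mul]
    have : (α ⊗ₖ β) * ρ * (α ⊗ₖ β) * ((a ⊗ₖ b) * (a ⊗ₖ b))
        = (α ⊗ₖ β) * (ρ * ((α ⊗ₖ β) * (a ⊗ₖ b)) * (a ⊗ₖ b)) := by simp only [mul_assoc]
    rw [this, ← hM.comm, hsupp, Matrix.trace_mul_comm, mul_assoc, hsupp, hρ.2]

lemma final_real {n : ℕ} (hn : 0 < n) {F Q : ℝ} (hQ : 1 ≤ Q)
    (h : 1 ≤ F ^ 2 * ((n : ℝ)⁻¹ * (n : ℝ)⁻¹ * (n * (Q + n - 1)))) :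
    ENNReal.ofReal (Real.sqrt (1 - F ^ 2) ^ 2) * ((ENNReal.ofReal Q - 1) + n)
      ≤ ENNReal.ofReal Q - 1 := by
  have hn' : (0 : ℝ) < n := by exact_mod_cast hn
  have e1 : ENNReal.ofReal Q - 1 = ENNReal.ofReal (Q - 1) := by
    rw [ENNReal.ofReal_sub _ zero_le_one, ENNReal.ofReal_one]
  have e2 : (n : ℝ≥0∞) = ENNReal.ofReal n := by simp
  rw [e1, e2, ← ENNReal.ofReal_add (by linarith) hn'.le, ← ENNReal.ofReal_mul (by positivity)]
  apply ENNReal.ofReal_le_ofReal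
  have h2 : (n : ℝ) ≤ F ^ 2 * (Q + n - 1) := by
    have := mul_le_mul_of_nonneg_left h hn'.le
    have e : (n : ℝ) * (F ^ 2 * ((n : ℝ)⁻¹ * (n : ℝ)⁻¹ * (n * (Q + n - 1)))) = F ^ 2 * (Q + n - 1) := by
      field_simp
    linarith
  rcases le_total 0 (1 - F ^ 2) with h0 | h0
  · rw [Real.sq_sqrt h0]; nlinarith
  · rw [Real.sqrt_eq_zero_of_nonpos h0]; simp; linarith

/-- **Purified-distance bound from the convex split lemma**:
`P²(τ, ρ^R ⊗ σ^{⊗n}) ≤ μ/(μ + n)` with `μ = Q₂(ρ^{RA} ‖ ρ^R ⊗ σ) − 1`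
(stated in the cross-multiplied form `P² · (μ + n) ≤ μ`, which is equivalent for
finite `μ` and correctly trivializes to `P² ≤ 1` when `μ = ∞`). -/
theorem convex_split_purified_distance_mu (n : ℕ) (hn : 0 < n)
    (ρ : Matrix (R × A) (R × A) ℂ) (hρ : IsDensity ρ)
    (σ : Matrix A A ℂ) (hσ : IsDensity σ) :
    ENNReal.ofReal
        (purifiedDist ((n : ℂ)⁻¹ • ∑ x : Fin n, tauX ρ σ n x) (ptrace2 ρ ⊗ₖ tpow σ n) ^ 2)
      * ((Q2 ρ (ptrace2 ρ ⊗ₖ σ) - 1) + n)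
      ≤ Q2 ρ (ptrace2 ρ ⊗ₖ σ) - 1 := by
  by_cases hs : suppLE ρ (ptrace2 ρ ⊗ₖ σ)
  swap
  · simp [Q2, hs]
  have hR := ptrace2_posSemidef hρ.1
  have ha := matPow_isPI hR
  have hb := matPow_isPI hσ.1
  have haa := matPow_half_mul_self hR
  have hbb := matPow_half_mul_self hσ.1
  generalize matPow (ptrace2 ρ) (1/2) = a at ha haa
  generalize matPow (ptrace2 ρ) (-(1/2)) = α at ha
  generalize matPow σ (1/2) = b at hb hbb
  generalize matPow σ (-(1/2)) = β at hb
  have hM := ha.kron hb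
  have hMM : (a ⊗ₖ b) * (a ⊗ₖ b) = ptrace2 ρ ⊗ₖ σ := by
    rw [← Matrix.mul_kronecker_mul, haa, hbb]
  have hsupp := supp_mul hM (by rw [hMM]; exact hs)
  have hQ : Q2 ρ (ptrace2 ρ ⊗ₖ σ)
      = ENNReal.ofReal (ρ * (α ⊗ₖ β) * ρ * (α ⊗ₖ β)).trace.re := by
    rw [Q2, if_pos hs, Q2R, ← hMM, matPow_neg_half_sq hM]
  have hQ1 : 1 ≤ (ρ * (α ⊗ₖ β) * ρ * (α ⊗ₖ β)).trace.re := by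
    refine q2_ge_one hM hρ.1.1 hsupp hρ.2 ?_
    rw [hMM, Matrix.trace_kronecker, ptrace2_trace, hρ.2, hσ.2, one_mul]
  rw [hQ, purifiedDist]
  refine final_real hn hQ1 ?_
  set τ := (n : ℂ)⁻¹ • ∑ x : Fin n, tauX ρ σ n x with hτ
  have hn0 : (n : ℂ) ≠ 0 := by exact_mod_cast hn.ne'
  have hS : IsPI (a ⊗ₖ tpow b n) (α ⊗ₖ tpow β n) := by
    rw [kron_tpow a b n ⟨0, hn⟩, kron_tpow α β n ⟨0, hn⟩]
    exact hM.tauX n _ hb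
  have hSS : (a ⊗ₖ tpow b n) * (a ⊗ₖ tpow b n) = ptrace2 ρ ⊗ₖ tpow σ n := by
    rw [kron_tpow a b n ⟨0, hn⟩, kron_tpow _ σ n ⟨0, hn⟩, tauX_mul, hMM, hbb]
  have hτpsd : τ.PosSemidef := by
    refine Matrix.PosSemidef.smul (Matrix.posSemidef_sum _ fun x _ =>
      tauX_posSemidef n x hρ.1 hσ.1) ?_
    have : (0 : ℂ) ≤ ((n : ℝ)⁻¹ : ℝ) := Complex.zero_le_real.2 (by positivity)
    simpa using this
  have hτtr : τ.trace = 1 := by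
    rw [hτ, Matrix.trace_smul, Matrix.trace_sum]
    simp only [tauX_trace ρ σ n _ hσ.2, hρ.2]
    simp [hn0]
  have hτsupp : τ * ((a ⊗ₖ tpow b n) * (α ⊗ₖ tpow β n)) = τ := by
    rw [hτ, smul_mul_assoc, Finset.sum_mul]
    congr 1
    refine Finset.sum_congr rfl fun x _ => ?_
    have hSPi : σ * (b * β) = σ := by
      rw [← hbb, hb.comm, mul_assoc, ← mul_assoc b β, hb.sts]
    rw [kron_tpow a b n x, kron_tpow α β n x, tauX_mul, tauX_mul, hsupp, hSPi]
  have key := fid_bound hS hτpsd hτsupp hτtr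
  rw [hSS] at key
  have htr : (τ * (α ⊗ₖ tpow β n) * τ * (α ⊗ₖ tpow β n)).trace
      = (n : ℂ)⁻¹ * (n : ℂ)⁻¹ *
        (n * ((ρ * (α ⊗ₖ β) * ρ * (α ⊗ₖ β)).trace + n - 1)) := by
    have e : τ * (α ⊗ₖ tpow β n) * τ * (α ⊗ₖ tpow β n)
        = ((n : ℂ)⁻¹ * (n : ℂ)⁻¹) • ∑ x : Fin n, ∑ y : Fin n,
          tauX ρ σ n x * (α ⊗ₖ tpow β n) * tauX ρ σ n y * (α ⊗ₖ tpow β n) := by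
      rw [hτ]
      simp only [smul_mul_assoc, mul_smul_comm, Finset.sum_mul, Finset.mul_sum]
      rw [Finset.sum_comm, ← Finset.smul_sum, smul_smul]
    rw [e, Matrix.trace_smul, Matrix.trace_sum]
    simp only [Matrix.trace_sum, trace_pair n ρ hρ σ hσ ha hb haa hbb hsupp]
    have : ∀ (x : Fin n) (q : ℂ), ∑ y : Fin n, (if y = x then q else 1) = q + n - 1 := by
      intro x q
      have : ∀ y : Fin n, (if y = x then q else 1) = (if y = x then q - 1 else 0) + 1 := by
        intro y; split_ifs <;> ring
      simp only [this, Finset.sum_add_distrib, Finset.sum_ite_eq', Finset.mem_univ, if_true]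
      simp
      ring
    simp only [this, smul_eq_mul, Finset.sum_const, Finset.card_univ, Fintype.card_fin,
      nsmul_eq_mul]
  have hre : (τ * (α ⊗ₖ tpow β n) * τ * (α ⊗ₖ tpow β n)).trace.re
      = (n : ℝ)⁻¹ * (n : ℝ)⁻¹ *
        (n * ((ρ * (α ⊗ₖ β) * ρ * (α ⊗ₖ β)).trace.re + n - 1)) := by
    rw [htr]
    have : (n : ℂ)⁻¹ * (n : ℂ)⁻¹ * (n * ((ρ * (α ⊗ₖ β) * ρ * (α ⊗ₖ β)).trace + n - 1))
      = (((n : ℝ)⁻¹ * (n : ℝ)⁻¹ * n : ℝ) : ℂ) *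
        ((ρ * (α ⊗ₖ β) * ρ * (α ⊗ₖ β)).trace + n - 1) := by push_cast; ring
    rw [this, Complex.re_ofReal_mul]
    simp only [Complex.add_re, Complex.sub_re, Complex.natCast_re, Complex.one_re]
    ring
  rw [hre] at key
  exact key
end
end

section
/- Let ε ∈ (0,1), let ρ be a density matrix on a finite-dimensional Hilbert space A of dimension d with eigenvalue vector p ∈ ℝ^d arranged in non-increasing order, and let f be a real-valued function on density matrices of A that is invariant under unitary conjugation (f(UσU*) = f(σ) for every density matrix σ and unitary U). Then min{ f(σ) : σ a density matrix with (1/2)‖ρ − σ‖₁ ≤ ε } = min{ f(diag(q)) : q ∈ ℝ^d a probability vector in non-increasing order with (1/2)‖p − q‖₁ ≤ ε }, where diag(q) denotes the density matrix with diagonal entries q in any fixed orthonormal basis. -/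
open scoped Matrix Kronecker BigOperators ENNReal ComplexOrder Classical

noncomputable section

variable {d : Type*} [Fintype d] [DecidableEq d]

/-- `A` is unitarily diagonalised by `V` with real diagonal `a`. -/
def Dec {n : ℕ} (A V : Matrix (Fin n) (Fin n) ℂ) (a : Fin n → ℝ) : Prop :=
  Vᴴ * V = 1 ∧ V * Vᴴ = 1 ∧ A = V * Matrix.diagonal (fun i => (a i : ℂ)) * Vᴴ

lemma Dec.perm {n : ℕ} {A V : Matrix (Fin n) (Fin n) ℂ} {a : Fin n → ℝ} (h : Dec A V a)
    (e : Equiv.Perm (Fin n)) : Dec A (V.submatrix id e) (a ∘ e) := by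
  obtain ⟨h1, h2, h3⟩ := h
  refine ⟨?_, ?_, ?_⟩
  · rw [Matrix.conjTranspose_submatrix, ← Matrix.submatrix_mul _ _ _ id _ Function.bijective_id, h1]
    exact Matrix.submatrix_one_equiv e
  · rw [Matrix.conjTranspose_submatrix, ← Matrix.submatrix_mul _ _ _ e _ e.bijective, h2]
    simp
  · have : Matrix.diagonal (fun i => (((a ∘ e) i : ℝ) : ℂ))
        = (Matrix.diagonal (fun i => (a i : ℂ))).submatrix e e := by
      rw [Matrix.submatrix_diagonal_equiv]; rfl
    rw [this, Matrix.conjTranspose_submatrix, ← Matrix.submatrix_mul _ _ _ e _ e.bijective,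
      ← Matrix.submatrix_mul _ _ _ e _ e.bijective, ← h3]
    simp

lemma dec_eig {n : ℕ} {A : Matrix (Fin n) (Fin n) ℂ} (hA : A.IsHermitian) :
    Dec A (hA.eigenvectorUnitary : Matrix (Fin n) (Fin n) ℂ) hA.eigenvalues := by
  refine ⟨?_, ?_, ?_⟩
  · exact Unitary.coe_star_mul_self hA.eigenvectorUnitary
  · exact Unitary.coe_mul_star_self hA.eigenvectorUnitary
  · have := hA.spectral_theorem
    rw [Unitary.conjStarAlgAut_apply] at this
    exact this

lemma exists_dec_antitone {n : ℕ} {A : Matrix (Fin n) (Fin n) ℂ} (hA : A.IsHermitian) :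
    ∃ V a, Antitone a ∧ Dec A V a := by
  refine ⟨_, _, ?_, (dec_eig hA).perm (Tuple.sort (fun i => - hA.eigenvalues i))⟩
  intro i j hij
  have := Tuple.monotone_sort (fun i => - hA.eigenvalues i) hij
  simpa using this

lemma Dec.herm {n : ℕ} {A V : Matrix (Fin n) (Fin n) ℂ} {a : Fin n → ℝ} (h : Dec A V a) :
    A.IsHermitian := by
  rw [h.2.2]
  apply Matrix.isHermitian_mul_mul_conjTranspose
  rw [Matrix.IsHermitian, Matrix.diagonal_conjTranspose]
  congr 1
  ext i
  simp

lemma Dec.trace {n : ℕ} {A V : Matrix (Fin n) (Fin n) ℂ} {a : Fin n → ℝ} (h : Dec A V a) :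
    A.trace = ((∑ i, a i : ℝ) : ℂ) := by
  rw [h.2.2, Matrix.trace_mul_comm, ← Matrix.mul_assoc, h.1, Matrix.one_mul, Matrix.trace_diagonal]
  simp

lemma Dec.sum_eig {n : ℕ} {A V : Matrix (Fin n) (Fin n) ℂ} {a : Fin n → ℝ} (h : Dec A V a)
    (hA : A.IsHermitian) (g : ℝ → ℝ) : ∑ i, g (hA.eigenvalues i) = ∑ i, g (a i) := by
  have h1 := hA.roots_charpoly_eq_eigenvalues
  have h2 : A.charpoly = ∏ i, (Polynomial.X - Polynomial.C (a i : ℂ)) := by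
    rw [h.2.2]
    rw [Matrix.charpoly_mul_comm, ← Matrix.mul_assoc, h.1, Matrix.one_mul,
      Matrix.charpoly_diagonal]
  have h4 : (∏ i, (Polynomial.X - Polynomial.C (a i : ℂ)))
      = ((Finset.univ.val.map (fun i => (a i : ℂ))).map
        (fun z => Polynomial.X - Polynomial.C z)).prod := by
    rw [Multiset.map_map]; rfl
  rw [h2, h4, Polynomial.roots_multiset_prod_X_sub_C] at h1
  have h3 := congrArg (fun s => (s.map (fun z : ℂ => g z.re)).sum) h1
  simpa [Multiset.map_map, Function.comp_def, List.sum_ofFn] using h3.symm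

lemma Dec.traceNorm {n : ℕ} {A V : Matrix (Fin n) (Fin n) ℂ} {a : Fin n → ℝ} (h : Dec A V a) :
    traceNorm A = ∑ i, |a i| := by
  have hd : Dec (Aᴴ * A) V (fun i => a i ^ 2) := by
    refine ⟨h.1, h.2.1, ?_⟩
    rw [h.herm.eq]
    have e : V * Matrix.diagonal (fun i => (a i : ℂ)) * Vᴴ *
        (V * Matrix.diagonal (fun i => (a i : ℂ)) * Vᴴ)
        = V * Matrix.diagonal (fun i => (a i : ℂ)) * (Vᴴ * V) *
          Matrix.diagonal (fun i => (a i : ℂ)) * Vᴴ := by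
      simp only [Matrix.mul_assoc]
    rw [h.2.2, e, h.1, Matrix.mul_one, Matrix.mul_assoc V, Matrix.diagonal_mul_diagonal]
    simp [sq]
  have hh := hd.herm
  unfold _root_.traceNorm matPow matFun
  rw [dif_pos hh]
  unfold herFun
  have hd2 : Dec ((hh.eigenvectorUnitary : Matrix (Fin n) (Fin n) ℂ) *
      Matrix.diagonal (fun i => (((fun x : ℝ => if x = 0 then 0 else Real.rpow x (1/2))
        (hh.eigenvalues i) : ℝ) : ℂ)) *
      (hh.eigenvectorUnitary : Matrix (Fin n) (Fin n) ℂ)ᴴ) _ _ :=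
    ⟨(dec_eig hh).1, (dec_eig hh).2.1, rfl⟩
  rw [hd2.trace, Complex.ofReal_re,
    hd.sum_eig hh (fun x : ℝ => if x = 0 then 0 else Real.rpow x (1/2))]
  refine Finset.sum_congr rfl fun i _ => ?_
  by_cases h0 : a i = 0
  · simp [h0]
  · rw [if_neg (by positivity)]
    change (a i ^ 2) ^ (1/2 : ℝ) = _
    rw [← Real.sqrt_eq_rpow, Real.sqrt_sq_eq_abs]

lemma quad_diag {n : ℕ} (a : Fin n → ℝ) (u : Fin n → ℂ) :
    star u ⬝ᵥ (Matrix.diagonal (fun i => (a i : ℂ)) *ᵥ u)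
      = ((∑ i, a i * ‖u i‖ ^ 2 : ℝ) : ℂ) := by
  simp only [dotProduct, Matrix.mulVec_diagonal, Complex.ofReal_sum]
  refine Finset.sum_congr rfl fun i _ => ?_
  have := Complex.conj_mul' (u i)
  simp only [Pi.star_apply, RCLike.star_def]
  push_cast
  rw [← this]; ring

lemma weyl {n : ℕ} {A B V W : Matrix (Fin n) (Fin n) ℂ} {a b : Fin n → ℝ}
    (hA : Dec A V a) (hB : Dec B W b) (ha : Antitone a) (hb : Antitone b)
    (hAB : (B - A).PosSemidef) (k : Fin n) : a k ≤ b k := by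
  obtain ⟨V1, V2, V3⟩ := hA
  obtain ⟨W1, W2, W3⟩ := hB
  set M := Wᴴ * V with hM
  let L : (Fin n → ℂ) →ₗ[ℂ] (Fin n → ℂ) :=
    LinearMap.pi fun j => if k < j then LinearMap.proj j
      else if j < k then (LinearMap.proj j).comp M.mulVecLin else 0
  have hns : ¬ Function.Surjective L := by
    intro hs
    obtain ⟨u, hu⟩ := hs (fun _ => 1)
    have := congrFun hu k
    simp [L] at this
  rw [← LinearMap.injective_iff_surjective, ← LinearMap.ker_eq_bot, Submodule.eq_bot_iff] at hns
  push Not at hns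
  obtain ⟨u, hu, hu0⟩ := hns
  rw [LinearMap.mem_ker] at hu
  have hu1 : ∀ j, k < j → u j = 0 := by
    intro j hj
    have := congrFun hu j
    simpa [L, hj] using this
  have hu2 : ∀ j, j < k → (M *ᵥ u) j = 0 := by
    intro j hj
    have := congrFun hu j
    simpa [L, hj, hj.not_gt] using this
  set w := M *ᵥ u with hw
  have hMM : Mᴴ * M = 1 := by
    rw [hM, Matrix.conjTranspose_mul, Matrix.conjTranspose_conjTranspose, Matrix.mul_assoc,
      ← Matrix.mul_assoc W, W2, Matrix.one_mul, V1]
  have quad : ∀ D : Matrix (Fin n) (Fin n) ℂ,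
      star w ⬝ᵥ (D *ᵥ w) = star u ⬝ᵥ ((Mᴴ * D * M) *ᵥ u) := by
    intro D
    rw [hw, Matrix.star_mulVec, ← Matrix.dotProduct_mulVec, Matrix.mulVec_mulVec,
      Matrix.mulVec_mulVec, Matrix.mul_assoc]
  have hpos := hAB.conjTranspose_mul_mul_same V
  have heq : Vᴴ * (B - A) * V = Mᴴ * Matrix.diagonal (fun i => (b i : ℂ)) * M
      - Matrix.diagonal (fun i => (a i : ℂ)) := by
    rw [Matrix.mul_sub, Matrix.sub_mul]
    congr 1
    · rw [W3, hM, Matrix.conjTranspose_mul, Matrix.conjTranspose_conjTranspose]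
      simp only [Matrix.mul_assoc]
    · have : Vᴴ * A * V = (Vᴴ * V) * Matrix.diagonal (fun i => (a i : ℂ)) * (Vᴴ * V) := by
        rw [V3]; simp only [Matrix.mul_assoc]
      rw [this, V1]; simp
  rw [heq] at hpos
  have hq := hpos.dotProduct_mulVec_nonneg u
  rw [Matrix.sub_mulVec, dotProduct_sub, ← quad, quad_diag, quad_diag, ← Complex.ofReal_sub] at hq
  have hq' : 0 ≤ ∑ i, b i * ‖w i‖ ^ 2 - ∑ i, a i * ‖u i‖ ^ 2 := by exact_mod_cast hq
  have hn : ∑ i, ‖w i‖ ^ 2 = ∑ i, ‖u i‖ ^ 2 := by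
    have h1 := quad 1
    rw [Matrix.mul_one, hMM] at h1
    have h2 := quad_diag (fun _ => (1:ℝ)) w
    have h3 := quad_diag (fun _ => (1:ℝ)) u
    simp only [Complex.ofReal_one, Matrix.diagonal_one, one_mul] at h2 h3
    rw [h2, h3] at h1
    exact_mod_cast h1
  have hb' : ∑ i, b i * ‖w i‖ ^ 2 ≤ b k * ∑ i, ‖w i‖ ^ 2 := by
    rw [Finset.mul_sum]
    refine Finset.sum_le_sum fun i _ => ?_
    by_cases hi : i < k
    · simp [hu2 i hi]
    · exact mul_le_mul_of_nonneg_right (hb (not_lt.mp hi)) (by positivity)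
  have ha' : a k * ∑ i, ‖u i‖ ^ 2 ≤ ∑ i, a i * ‖u i‖ ^ 2 := by
    rw [Finset.mul_sum]
    refine Finset.sum_le_sum fun i _ => ?_
    by_cases hi : k < i
    · simp [hu1 i hi]
    · exact mul_le_mul_of_nonneg_right (ha (not_lt.mp hi)) (by positivity)
  have hupos : 0 < ∑ i, ‖u i‖ ^ 2 := by
    obtain ⟨i, hi⟩ := Function.ne_iff.mp hu0
    refine Finset.sum_pos' (fun _ _ => by positivity) ⟨i, Finset.mem_univ _, ?_⟩
    have : 0 < ‖u i‖ := norm_pos_iff.mpr hi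
    positivity
  rw [hn] at hb'
  exact le_of_mul_le_mul_right (by linarith) hupos

lemma posSemidef_conj_diag {n : ℕ} (V : Matrix (Fin n) (Fin n) ℂ) (a : Fin n → ℝ)
    (ha : ∀ i, 0 ≤ a i) : (V * Matrix.diagonal (fun i => (a i : ℂ)) * Vᴴ).PosSemidef := by
  apply Matrix.PosSemidef.mul_mul_conjTranspose_same
  rw [Matrix.posSemidef_diagonal_iff]
  intro i
  exact_mod_cast ha i

lemma mirsky {n : ℕ} {A B V W : Matrix (Fin n) (Fin n) ℂ} {a b : Fin n → ℝ}
    (hA : Dec A V a) (hB : Dec B W b) (ha : Antitone a) (hb : Antitone b) :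
    ∑ i, |a i - b i| ≤ traceNorm (A - B) := by
  have hH : (A - B).IsHermitian := hA.herm.sub hB.herm
  have hd := dec_eig hH
  set U := (hH.eigenvectorUnitary : Matrix (Fin n) (Fin n) ℂ)
  set h := hH.eigenvalues
  set P := U * Matrix.diagonal (fun i => ((max (h i) 0 : ℝ) : ℂ)) * Uᴴ with hP
  set N := U * Matrix.diagonal (fun i => ((max (-h i) 0 : ℝ) : ℂ)) * Uᴴ with hN
  have hPd : Dec P U (fun i => max (h i) 0) := ⟨hd.1, hd.2.1, rfl⟩
  have hPp : P.PosSemidef := posSemidef_conj_diag U _ (fun i => le_max_right _ _)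
  have hNp : N.PosSemidef := posSemidef_conj_diag U _ (fun i => le_max_right _ _)
  have hPN : A - B = P - N := by
    rw [hd.2.2, hP, hN, ← Matrix.sub_mul, ← Matrix.mul_sub, Matrix.diagonal_sub]
    congr 3
    ext i
    rw [← Complex.ofReal_sub]
    congr 1
    rcases le_total (h i) 0 with h0 | h0
    · rw [max_eq_right h0, max_eq_left (by linarith)]; ring
    · rw [max_eq_left h0, max_eq_right (by linarith)]; ring
  obtain ⟨X, t, ht, hT⟩ := exists_dec_antitone (hB.herm.add hPp.1)
  have hbt := weyl hB hT hb ht (by simpa using hPp)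
  have hat := weyl hA hT ha ht (by
    have : B + P - A = N := by
      rw [sub_eq_sub_iff_add_eq_add] at hPN
      rw [sub_eq_iff_eq_add, add_comm B, ← hPN, add_comm]
    rw [this]; exact hNp)
  have hst : ∑ i, t i = ∑ i, b i + ∑ i, max (h i) 0 := by
    have := hT.trace
    rw [Matrix.trace_add, hB.trace, hPd.trace] at this
    exact_mod_cast this.symm
  have hsh : ∑ i, h i = ∑ i, a i - ∑ i, b i := by
    have := hd.trace
    rw [Matrix.trace_sub, hA.trace, hB.trace] at this
    exact_mod_cast this.symm
  rw [hd.traceNorm]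
  have e1 : ∑ i, |h i| = 2 * ∑ i, max (h i) 0 - ∑ i, h i := by
    rw [Finset.mul_sum, ← Finset.sum_sub_distrib]
    refine Finset.sum_congr rfl fun i _ => ?_
    rcases le_total (h i) 0 with h0 | h0
    · rw [max_eq_right h0, abs_of_nonpos h0]; ring
    · rw [max_eq_left h0, abs_of_nonneg h0]; ring
  have e2 : ∑ i, |a i - b i| ≤ 2 * ∑ i, t i - ∑ i, a i - ∑ i, b i := by
    rw [Finset.mul_sum, ← Finset.sum_sub_distrib, ← Finset.sum_sub_distrib]
    refine Finset.sum_le_sum fun i _ => ?_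
    have := hbt i
    have := hat i
    rw [abs_le]; constructor <;> linarith
  linarith

lemma Dec.f_eq {n : ℕ} {A V : Matrix (Fin n) (Fin n) ℂ} {a : Fin n → ℝ} (h : Dec A V a)
    (f : Matrix (Fin n) (Fin n) ℂ → ℝ)
    (hf : ∀ σ : Matrix (Fin n) (Fin n) ℂ, IsDensity σ →
      ∀ U : Matrix.unitaryGroup (Fin n) ℂ,
        f ((U : Matrix (Fin n) (Fin n) ℂ) * σ * star (U : Matrix (Fin n) (Fin n) ℂ)) = f σ)
    (h0 : ∀ i, 0 ≤ a i) (h1 : ∑ i, a i = 1) :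
    f A = f (Matrix.diagonal (fun i => (a i : ℂ))) := by
  rw [h.2.2]
  refine hf _ ⟨?_, ?_⟩ ⟨V, Matrix.mem_unitaryGroup_iff.mpr h.2.1⟩
  · rw [Matrix.posSemidef_diagonal_iff]
    intro i
    exact_mod_cast h0 i
  · rw [Matrix.trace_diagonal]
    exact_mod_cast h1

/-- **Smoothing a unitarily invariant function can be done on the spectrum**:
for `f` invariant under unitary conjugation,
`min{ f(σ) : (1/2)‖ρ − σ‖₁ ≤ ε } = min{ f(diag q) : q` a non-increasing probability
vector with `(1/2)‖p − q‖₁ ≤ ε }`, where `p` is the sorted spectrum of `ρ`. -/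
theorem smoothing_unitarily_invariant (dd : ℕ) (ε : ℝ) (hε : ε ∈ Set.Ioo (0 : ℝ) 1)
    (ρ : Matrix (Fin dd) (Fin dd) ℂ) (hρ : IsDensity ρ)
    (p : Fin dd → ℝ) (hpa : Antitone p)
    (hp : ∃ e : Equiv.Perm (Fin dd), ∀ i, p i = hρ.1.1.eigenvalues (e i))
    (f : Matrix (Fin dd) (Fin dd) ℂ → ℝ)
    (hf : ∀ σ : Matrix (Fin dd) (Fin dd) ℂ, IsDensity σ →
      ∀ U : Matrix.unitaryGroup (Fin dd) ℂ,
        f ((U : Matrix (Fin dd) (Fin dd) ℂ) * σ * star (U : Matrix (Fin dd) (Fin dd) ℂ)) = f σ) :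
    sInf {y : ℝ | ∃ σ : Matrix (Fin dd) (Fin dd) ℂ,
        IsDensity σ ∧ (1/2) * traceNorm (ρ - σ) ≤ ε ∧ y = f σ}
      = sInf {y : ℝ | ∃ q : Fin dd → ℝ, (∀ i, 0 ≤ q i) ∧ (∑ i, q i) = 1 ∧ Antitone q ∧
          (1/2) * (∑ i, |p i - q i|) ≤ ε ∧ y = f (Matrix.diagonal (fun i => (q i : ℂ)))} := by
  obtain ⟨e, he⟩ := hp
  have hρd := (dec_eig hρ.1.1).perm e
  have hpe : hρ.1.1.eigenvalues ∘ e = p := by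
    ext i; exact (he i).symm
  rw [hpe] at hρd
  set V := (hρ.1.1.eigenvectorUnitary : Matrix (Fin dd) (Fin dd) ℂ).submatrix id e
  congr 1
  ext y
  simp only [Set.mem_ofPred_eq]
  constructor
  · rintro ⟨σ, hσ, hd, rfl⟩
    obtain ⟨W, q, hq, hW⟩ := exists_dec_antitone hσ.1.1
    have hq0 : ∀ i, 0 ≤ q i := by
      have h := hσ.1.conjTranspose_mul_mul_same W
      have e : Wᴴ * σ * W = Matrix.diagonal (fun i => (q i : ℂ)) := by
        have : Wᴴ * σ * W = (Wᴴ * W) * Matrix.diagonal (fun i => (q i : ℂ)) * (Wᴴ * W) := by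
          conv_lhs => rw [hW.2.2]
          simp only [Matrix.mul_assoc]
        rw [this, hW.1]; simp
      rw [e, Matrix.posSemidef_diagonal_iff] at h
      intro i
      exact_mod_cast h i
    have hq1 : ∑ i, q i = 1 := by
      have := hW.trace
      rw [hσ.2] at this
      exact_mod_cast this.symm
    refine ⟨q, hq0, hq1, hq, ?_, hW.f_eq f hf hq0 hq1⟩
    have := mirsky hρd hW hpa hq
    linarith
  · rintro ⟨q, hq0, hq1, hq, hd, rfl⟩
    have hW : Dec (V * Matrix.diagonal (fun i => (q i : ℂ)) * Vᴴ) V q := ⟨hρd.1, hρd.2.1, rfl⟩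
    refine ⟨_, ⟨posSemidef_conj_diag V q hq0, ?_⟩, ?_, (hW.f_eq f hf hq0 hq1).symm⟩
    · rw [hW.trace, hq1]; simp
    · have hD : Dec (ρ - V * Matrix.diagonal (fun i => (q i : ℂ)) * Vᴴ) V (fun i => p i - q i) := by
        refine ⟨hρd.1, hρd.2.1, ?_⟩
        conv_lhs => rw [hρd.2.2]
        rw [← Matrix.sub_mul, ← Matrix.mul_sub, Matrix.diagonal_sub]
        simp
      rw [hD.traceNorm]
      exact hd
end
end
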